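/- Every solution ω₂ : (0,π) → ℝ of the ODE 3cos(θ)·ω₂'(θ) + sin(θ)·ω₂''(θ) − 2·ω₂(θ)·sin(θ) = 0 that extends continuously to [0,π] together with its relevant boundedness (i.e. ω₂ is bounded on (0,π) and has finite limits at 0 and π) must be identically zero, provided neither of the two linearly independent singular/growing solutions is regular; concretely: the only solution bounded together with ω₂' ⋅ sin(θ) near both endpoints is ω₂ ≡ 0. -/

import Mathlib

open Set Real Filter

/-- If `sin θ u'' + 3 cos θ u' = 2 sin θ u` at `θ`, the energy flux `sin³θ u u'` has
derivative `sin³θ (2 u² + u'²)` there. -/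
lemma hasDerivAt_sin_cube_mul_mul_deriv {u : ℝ → ℝ} {θ : ℝ}
    (hu : DifferentiableAt ℝ u θ) (hu' : DifferentiableAt ℝ (deriv u) θ)
    (hODE : 3 * Real.cos θ * deriv u θ + Real.sin θ * deriv (deriv u) θ
      - 2 * u θ * Real.sin θ = 0) :
    HasDerivAt (fun x => Real.sin x ^ 3 * (u x * deriv u x))
      (Real.sin θ ^ 3 * (2 * u θ ^ 2 + deriv u θ ^ 2)) θ := by
  refine (((Real.hasDerivAt_sin θ).pow 3).mul
    (hu.hasDerivAt.mul hu'.hasDerivAt)).congr_deriv ?_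
  simp only [Pi.mul_apply, Pi.pow_apply]
  push_cast
  linear_combination Real.sin θ ^ 2 * u θ * hODE

/-- The only solution `ω₂` of `3 cos θ ω₂' + sin θ ω₂'' − 2 ω₂ sin θ = 0` on
`(0, π)` that is bounded together with `ω₂' · sin θ` near both endpoints and
has finite limits at `0` and `π` is `ω₂ ≡ 0`. -/
theorem omega2_vanishes (ω₂ : ℝ → ℝ)
    (hsmooth : ContDiffOn ℝ (⊤ : ℕ∞) ω₂ (Ioo 0 π))
    (hODE : ∀ θ ∈ Ioo (0 : ℝ) π,
      3 * Real.cos θ * deriv ω₂ θ + Real.sin θ * deriv (deriv ω₂) θ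
        - 2 * ω₂ θ * Real.sin θ = 0)
    (hbdd : ∃ C : ℝ, ∀ θ ∈ Ioo (0 : ℝ) π,
      |ω₂ θ| ≤ C ∧ |deriv ω₂ θ * Real.sin θ| ≤ C)
    (hlim0 : ∃ L₀ : ℝ, Tendsto ω₂ (nhdsWithin 0 (Ioo 0 π)) (nhds L₀))
    (hlimπ : ∃ Lπ : ℝ, Tendsto ω₂ (nhdsWithin π (Ioo 0 π)) (nhds Lπ)) :
    ∀ θ ∈ Ioo (0 : ℝ) π, ω₂ θ = 0 := by
  have hdiff : ∀ θ ∈ Ioo (0 : ℝ) π,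
      DifferentiableAt ℝ ω₂ θ ∧ DifferentiableAt ℝ (deriv ω₂) θ := fun θ hθ =>
    ⟨(hsmooth.contDiffAt (isOpen_Ioo.mem_nhds hθ)).differentiableAt (by simp),
      ((hsmooth.deriv_of_isOpen (m := (⊤ : ℕ∞)) isOpen_Ioo le_rfl).contDiffAt
        (isOpen_Ioo.mem_nhds hθ)).differentiableAt (by simp)⟩
  set F : ℝ → ℝ := fun x => Real.sin x ^ 3 * (ω₂ x * deriv ω₂ x)
  have hderiv : ∀ θ ∈ Ioo (0 : ℝ) π,
      HasDerivAt F (Real.sin θ ^ 3 * (2 * ω₂ θ ^ 2 + deriv ω₂ θ ^ 2)) θ := fun θ hθ =>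
    hasDerivAt_sin_cube_mul_mul_deriv (hdiff θ hθ).1 (hdiff θ hθ).2 (hODE θ hθ)
  have hmono : MonotoneOn F (Ioo 0 π) := by
    refine monotoneOn_of_deriv_nonneg (convex_Ioo _ _)
      (fun θ hθ => (hderiv θ hθ).continuousAt.continuousWithinAt)
      (fun θ hθ => (hderiv θ (interior_subset hθ)).differentiableAt.differentiableWithinAt)
      fun θ hθ => ?_
    have hθ' := interior_subset hθ
    have := Real.sin_pos_of_mem_Ioo hθ'
    rw [(hderiv θ hθ').deriv]
    positivity
  obtain ⟨C, hC⟩ := hbdd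
  have hbound : ∀ θ ∈ Ioo (0 : ℝ) π, |F θ| ≤ C ^ 2 * Real.sin θ ^ 2 := fun θ hθ => by
    obtain ⟨h₁, h₂⟩ := hC θ hθ
    have hmul := mul_le_mul h₁ h₂ (abs_nonneg _) ((abs_nonneg _).trans h₁)
    calc |F θ| = |ω₂ θ| * |deriv ω₂ θ * Real.sin θ| * Real.sin θ ^ 2 := by
          rw [← sq_abs (Real.sin θ), ← abs_pow, ← abs_mul, ← abs_mul]
          congr 1
          ring
      _ ≤ C * C * Real.sin θ ^ 2 := by gcongr
      _ = C ^ 2 * Real.sin θ ^ 2 := by ring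
  have hlim : ∀ a : ℝ, Real.sin a = 0 → ∀ s : Set ℝ,
      Tendsto (fun x => C ^ 2 * Real.sin x ^ 2) (nhdsWithin a s) (nhds 0) := fun a ha s => by
    have h : Continuous fun x => C ^ 2 * Real.sin x ^ 2 := by fun_prop
    simpa [ha] using (h.tendsto a).mono_left nhdsWithin_le_nhds
  have hzero : ∀ θ ∈ Ioo (0 : ℝ) π, F θ = 0 := fun θ hθ => by
    apply le_antisymm
    · refine ge_of_tendsto (hlim π Real.sin_pi (Iio π)) ?_
      filter_upwards [Ioo_mem_nhdsLT hθ.2] with y hy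
      have hy' : y ∈ Ioo (0 : ℝ) π := ⟨hθ.1.trans hy.1, hy.2⟩
      exact (hmono hθ hy' hy.1.le).trans ((le_abs_self _).trans (hbound y hy'))
    · refine neg_nonpos.1 (ge_of_tendsto (hlim 0 Real.sin_zero (Ioi 0)) ?_)
      filter_upwards [Ioo_mem_nhdsGT hθ.1] with y hy
      have hy' : y ∈ Ioo (0 : ℝ) π := ⟨hy.1, hy.2.trans hθ.2⟩
      exact (neg_le_neg (hmono hy' hθ hy.2.le)).trans
        ((neg_le_abs _).trans (hbound y hy'))
  intro θ hθ
  have hconst : HasDerivAt F 0 θ := (hasDerivAt_const θ (0 : ℝ)).congr_of_eventuallyEq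
    (eventually_of_mem (isOpen_Ioo.mem_nhds hθ) hzero)
  have hsum := (mul_eq_zero.1 ((hderiv θ hθ).unique hconst)).resolve_left
    (pow_pos (Real.sin_pos_of_mem_Ioo hθ) 3).ne'
  exact pow_eq_zero_iff two_ne_zero |>.1
    (by linarith [sq_nonneg (ω₂ θ), sq_nonneg (deriv ω₂ θ)])
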